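/- arXiv:math/0208140 — 2 statements merged into one kernel-verified Lean document; each statement's English description precedes it below -/
import Mathlib

section
/- For the generators of U^tw_q(sp_2n), the coproduct of U_q(gl_2n) satisfies Δ(s_ij) = Σ_{k,l=1}^{2n} t_ik t̄_jl ⊗ s_kl and Δ(s_{ii′}^{−1}) = t_{i′i′} t̄_ii ⊗ s_{ii′}^{−1} for odd i. Consequently U^tw_q(sp_2n) is a left coideal of U_q(gl_2n): Δ(U^tw_q(sp_2n)) ⊆ U_q(gl_2n) ⊗ U^tw_q(sp_2n). -/
noncomputable section

open scoped TensorProduct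

abbrev FF : Type := RatFunc ℂ

def qq : FF := RatFunc.X

/-! Constant R-matrices acting in `ℂ^N ⊗ ℂ^N`, written as matrices indexed by pairs. -/

def Rc (F : Type) [Field F] (q : F) (N : ℕ) :
    Matrix (Fin N × Fin N) (Fin N × Fin N) F := Matrix.of fun p r =>
  (if p = r then (if p.1 = p.2 then q else 1) else 0)
  + (if p.1 = r.2 ∧ p.2 = r.1 ∧ p.1 < p.2 then q - q⁻¹ else 0)

/-- `R` transposed in the first tensor factor. -/
def Rct (F : Type) [Field F] (q : F) (N : ℕ) :
    Matrix (Fin N × Fin N) (Fin N × Fin N) F :=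
  Matrix.of fun p r => Rc F q N (r.1, p.2) (p.1, r.2)

def Rtil (F : Type) [Field F] (q : F) (N : ℕ) :
    Matrix (Fin N × Fin N) (Fin N × Fin N) F := Matrix.of fun p r =>
  (if p = r then (if p.1 = p.2 then q⁻¹ else 1) else 0)
  + (if p.1 = r.2 ∧ p.2 = r.1 ∧ p.2 < p.1 then q⁻¹ - q else 0)

def Rtilt (F : Type) [Field F] (q : F) (N : ℕ) :
    Matrix (Fin N × Fin N) (Fin N × Fin N) F :=
  Matrix.of fun p r => Rtil F q N (r.1, p.2) (p.1, r.2)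

/-- `S ↦ S ⊗ 1` (action in the first copy of `End ℂ^N`). -/
def amp1 {A : Type} [Ring A] {N : ℕ} (M : Matrix (Fin N) (Fin N) A) :
    Matrix (Fin N × Fin N) (Fin N × Fin N) A :=
  Matrix.of fun p r => if p.2 = r.2 then M p.1 r.1 else 0

/-- `S ↦ 1 ⊗ S` (action in the second copy of `End ℂ^N`). -/
def amp2 {A : Type} [Ring A] {N : ℕ} (M : Matrix (Fin N) (Fin N) A) :
    Matrix (Fin N × Fin N) (Fin N × Fin N) A :=
  Matrix.of fun p r => if p.1 = r.1 then M p.2 r.2 else 0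

/-- A scalar matrix viewed as a matrix over an `F`-algebra `A`. -/
def liftF (F : Type) [Field F] {A : Type} [Ring A] [Algebra F A] {m : Type}
    (M : Matrix m m F) : Matrix m m A := M.map (algebraMap F A)

/-- Left hand side `R S₁ Rᵗ S₂` of the reflection equation. -/
def reflLHS (F : Type) [Field F] (q : F) {N : ℕ} {A : Type} [Ring A] [Algebra F A]
    (S : Matrix (Fin N) (Fin N) A) : Matrix (Fin N × Fin N) (Fin N × Fin N) A :=
  liftF F (Rc F q N) * amp1 S * liftF F (Rct F q N) * amp2 S

/-- Right hand side `S₂ Rᵗ S₁ R` of the reflection equation. -/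
def reflRHS (F : Type) [Field F] (q : F) {N : ℕ} {A : Type} [Ring A] [Algebra F A]
    (S : Matrix (Fin N) (Fin N) A) : Matrix (Fin N × Fin N) (Fin N × Fin N) A :=
  amp2 S * liftF F (Rct F q N) * amp1 S * liftF F (Rc F q N)

/-- The list of index pairs `(i,j)` in lexicographic order. -/
def lexPairs (N : ℕ) : List (Fin N × Fin N) :=
  (List.finRange N).flatMap fun i => (List.finRange N).map fun j => (i, j)

/-! The generic matrix of generators. -/

def Sfree (F : Type) [Field F] (N : ℕ) :
    Matrix (Fin N) (Fin N) (FreeAlgebra F (Fin N × Fin N)) :=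
  Matrix.of fun i j => FreeAlgebra.ι F (i, j)

/-- Defining relations: only the reflection equation. -/
inductive Rel0 (F : Type) [Field F] (q : F) (N : ℕ) :
    FreeAlgebra F (Fin N × Fin N) → FreeAlgebra F (Fin N × Fin N) → Prop
  | refl (p r : Fin N × Fin N) :
      Rel0 F q N (reflLHS F q (Sfree F N) p r) (reflRHS F q (Sfree F N) p r)

/-- The algebra with generators `s_ij` and the reflection equation as defining relations. -/
abbrev Alg0 (F : Type) [Field F] (q : F) (N : ℕ) := RingQuot (Rel0 F q N)

def s0 (F : Type) [Field F] (q : F) (N : ℕ) (i j : Fin N) : Alg0 F q N :=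
  RingQuot.mkAlgHom F (Rel0 F q N) (FreeAlgebra.ι F (i, j))

/-- Defining relations of the presented algebra `𝒮` of the orthogonal case. -/
inductive OSRel (F : Type) [Field F] (q : F) (N : ℕ) :
    FreeAlgebra F (Fin N × Fin N) → FreeAlgebra F (Fin N × Fin N) → Prop
  | tri (i j : Fin N) (h : i < j) : OSRel F q N (FreeAlgebra.ι F (i, j)) 0
  | diag (i : Fin N) : OSRel F q N (FreeAlgebra.ι F (i, i)) 1
  | refl (p r : Fin N × Fin N) :
      OSRel F q N (reflLHS F q (Sfree F N) p r) (reflRHS F q (Sfree F N) p r)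

abbrev AlgOS (F : Type) [Field F] (q : F) (N : ℕ) := RingQuot (OSRel F q N)

def sOS (F : Type) [Field F] (q : F) (N : ℕ) (i j : Fin N) : AlgOS F q N :=
  RingQuot.mkAlgHom F (OSRel F q N) (FreeAlgebra.ι F (i, j))

/-! The quantized enveloping algebra `U_q(gl_N)` by its RTT presentation. -/

abbrev GlGen (N : ℕ) := (Fin N × Fin N) ⊕ (Fin N × Fin N)

def Tfree (F : Type) [Field F] (N : ℕ) :
    Matrix (Fin N) (Fin N) (FreeAlgebra F (GlGen N)) :=
  Matrix.of fun i j => FreeAlgebra.ι F (Sum.inl (i, j))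

def Tbfree (F : Type) [Field F] (N : ℕ) :
    Matrix (Fin N) (Fin N) (FreeAlgebra F (GlGen N)) :=
  Matrix.of fun i j => FreeAlgebra.ι F (Sum.inr (i, j))

/-- `R X₁ Y₂` -/
def rttLHS (F : Type) [Field F] (q : F) {N : ℕ} {A : Type} [Ring A] [Algebra F A]
    (X Y : Matrix (Fin N) (Fin N) A) : Matrix (Fin N × Fin N) (Fin N × Fin N) A :=
  liftF F (Rc F q N) * amp1 X * amp2 Y

/-- `Y₂ X₁ R` -/
def rttRHS (F : Type) [Field F] (q : F) {N : ℕ} {A : Type} [Ring A] [Algebra F A]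
    (X Y : Matrix (Fin N) (Fin N) A) : Matrix (Fin N × Fin N) (Fin N × Fin N) A :=
  amp2 Y * amp1 X * liftF F (Rc F q N)

inductive GlRel (F : Type) [Field F] (q : F) (N : ℕ) :
    FreeAlgebra F (GlGen N) → FreeAlgebra F (GlGen N) → Prop
  | t_zero (i j : Fin N) (h : i < j) : GlRel F q N (Tfree F N i j) 0
  | tb_zero (i j : Fin N) (h : j < i) : GlRel F q N (Tbfree F N i j) 0
  | t_tb (i : Fin N) : GlRel F q N (Tfree F N i i * Tbfree F N i i) 1
  | tb_t (i : Fin N) : GlRel F q N (Tbfree F N i i * Tfree F N i i) 1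
  | rtt (p r : Fin N × Fin N) :
      GlRel F q N (rttLHS F q (Tfree F N) (Tfree F N) p r)
        (rttRHS F q (Tfree F N) (Tfree F N) p r)
  | rtbtb (p r : Fin N × Fin N) :
      GlRel F q N (rttLHS F q (Tbfree F N) (Tbfree F N) p r)
        (rttRHS F q (Tbfree F N) (Tbfree F N) p r)
  | rtbt (p r : Fin N × Fin N) :
      GlRel F q N (rttLHS F q (Tbfree F N) (Tfree F N) p r)
        (rttRHS F q (Tbfree F N) (Tfree F N) p r)

/-- The quantized enveloping algebra `U_q(gl_N)`. -/
abbrev UqGl (F : Type) [Field F] (q : F) (N : ℕ) := RingQuot (GlRel F q N)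

def tE (F : Type) [Field F] (q : F) (N : ℕ) (i j : Fin N) : UqGl F q N :=
  RingQuot.mkAlgHom F (GlRel F q N) (FreeAlgebra.ι F (Sum.inl (i, j)))

def tbE (F : Type) [Field F] (q : F) (N : ℕ) (i j : Fin N) : UqGl F q N :=
  RingQuot.mkAlgHom F (GlRel F q N) (FreeAlgebra.ι F (Sum.inr (i, j)))

/-- The entries `s_ij = Σ_a t_ia t̄_ja` of `S = T T̄ᵗ`. -/
def sE (F : Type) [Field F] (q : F) (N : ℕ) (i j : Fin N) : UqGl F q N :=
  ∑ a : Fin N, tE F q N i a * tbE F q N j a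

/-- The twisted quantized enveloping algebra `U^tw_q(o_N)` as a subalgebra of `U_q(gl_N)`. -/
def UtwO (F : Type) [Field F] (q : F) (N : ℕ) : Subalgebra F (UqGl F q N) :=
  Algebra.adjoin F {x | ∃ i j, x = sE F q N i j}

/-! Symplectic (finite) case. -/

/-- `2k` as an element of `Fin (2n)` (the 0-based version of the odd index `2k-1`). -/
def fe (n : ℕ) (k : Fin n) : Fin (2 * n) := ⟨2 * k.val, by have := k.isLt; omega⟩

/-- `2k+1` as an element of `Fin (2n)` (the 0-based version of the even index `2k`). -/
def fo (n : ℕ) (k : Fin n) : Fin (2 * n) := ⟨2 * k.val + 1, by have := k.isLt; omega⟩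

/-- The entries `s_ij` of `S = T G T̄ᵗ` in `U_q(gl_2n)`. -/
def sSp (F : Type) [Field F] (q : F) (n : ℕ) (i j : Fin (2 * n)) : UqGl F q (2 * n) :=
  algebraMap F _ q * ∑ a : Fin n, tE F q (2 * n) i (fe n a) * tbE F q (2 * n) j (fo n a)
    - ∑ a : Fin n, tE F q (2 * n) i (fo n a) * tbE F q (2 * n) j (fe n a)

abbrev SpGen (n : ℕ) := (Fin (2 * n) × Fin (2 * n)) ⊕ Fin n

def SpFreeS (F : Type) [Field F] (n : ℕ) :
    Matrix (Fin (2 * n)) (Fin (2 * n)) (FreeAlgebra F (SpGen n)) :=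
  Matrix.of fun i j => FreeAlgebra.ι F (Sum.inl (i, j))

/-- Defining relations of the presented algebra `𝒮` of the symplectic case. -/
inductive SpRel (F : Type) [Field F] (q : F) (n : ℕ) :
    FreeAlgebra F (SpGen n) → FreeAlgebra F (SpGen n) → Prop
  | tri (i j : Fin (2 * n)) (h : i < j) (h' : ¬(i.val % 2 = 0 ∧ j.val = i.val + 1)) :
      SpRel F q n (FreeAlgebra.ι F (Sum.inl (i, j))) 0
  | quad (k : Fin n) :
      SpRel F q n
        (FreeAlgebra.ι F (Sum.inl (fo n k, fo n k)) * FreeAlgebra.ι F (Sum.inl (fe n k, fe n k)))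
        (algebraMap F _ (q ^ 2) *
            (FreeAlgebra.ι F (Sum.inl (fo n k, fe n k)) *
              FreeAlgebra.ι F (Sum.inl (fe n k, fo n k)))
          + algebraMap F _ (q ^ 3))
  | invR (k : Fin n) :
      SpRel F q n
        (FreeAlgebra.ι F (Sum.inl (fe n k, fo n k)) * FreeAlgebra.ι F (Sum.inr k)) 1
  | invL (k : Fin n) :
      SpRel F q n
        (FreeAlgebra.ι F (Sum.inr k) * FreeAlgebra.ι F (Sum.inl (fe n k, fo n k))) 1
  | refl (p r : Fin (2 * n) × Fin (2 * n)) :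
      SpRel F q n (reflLHS F q (SpFreeS F n) p r) (reflRHS F q (SpFreeS F n) p r)

abbrev AlgSp (F : Type) [Field F] (q : F) (n : ℕ) := RingQuot (SpRel F q n)

def sSpP (F : Type) [Field F] (q : F) (n : ℕ) (i j : Fin (2 * n)) : AlgSp F q n :=
  RingQuot.mkAlgHom F (SpRel F q n) (FreeAlgebra.ι F (Sum.inl (i, j)))

def sInvP (F : Type) [Field F] (q : F) (n : ℕ) (k : Fin n) : AlgSp F q n :=
  RingQuot.mkAlgHom F (SpRel F q n) (FreeAlgebra.ι F (Sum.inr k))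

/-- row `i = 2k` of the symplectic ordered monomial: positions `(i,0),…,(i,2k)`. -/
def rowA (n : ℕ) (k : Fin n) : List (Fin (2 * n) × Fin (2 * n)) :=
  ((List.finRange (2 * n)).filter fun j => j.val ≤ 2 * k.val).map fun j => (fe n k, j)

/-- row `i' = 2k+1` of the symplectic ordered monomial: positions `(i',0),…,(i',2k-1)`. -/
def rowB (n : ℕ) (k : Fin n) : List (Fin (2 * n) × Fin (2 * n)) :=
  ((List.finRange (2 * n)).filter fun j => j.val + 2 ≤ 2 * k.val + 1).map fun j => (fo n k, j)

/-- The ordered monomials of the symplectic case, with an arbitrary integer exponent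
on each `s_{i i'}` and nonnegative exponents elsewhere. -/
def monomSp {A : Type} [Ring A] (n : ℕ) (s : Fin (2 * n) × Fin (2 * n) → A) (sI : Fin n → A)
    (kN : Fin (2 * n) × Fin (2 * n) → ℕ) (kZ : Fin n → ℤ) : A :=
  ((List.finRange n).map fun k =>
    ((rowA n k).map fun p => s p ^ kN p).prod *
      (if 0 ≤ kZ k then s (fe n k, fo n k) ^ (kZ k).toNat else sI k ^ (-(kZ k)).toNat) *
      s (fo n k, fo n k) ^ kN (fo n k, fo n k) *
      ((rowB n k).map fun p => s p ^ kN p).prod).prod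

/-! Affine (twisted q-Yangian) machinery.  Series are treated coefficientwise. -/

/-- `z1 S r` is the coefficient matrix (in the first copy) of a series indexed by
nonnegative integers, extended by zero to `ℤ`. -/
def z1 {A : Type} [Ring A] {N : ℕ} (S : ℕ → Matrix (Fin N) (Fin N) A) (r : ℤ) :
    Matrix (Fin N × Fin N) (Fin N × Fin N) A :=
  if 0 ≤ r then amp1 (S r.toNat) else 0

def z2 {A : Type} [Ring A] {N : ℕ} (S : ℕ → Matrix (Fin N) (Fin N) A) (r : ℤ) :
    Matrix (Fin N × Fin N) (Fin N × Fin N) A :=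
  if 0 ≤ r then amp2 (S r.toNat) else 0

/-- Coefficient of `u^a v^b` in `R(u,v) S₁(u) Rᵗ(u⁻¹,v) S₂(v)`,
using `R(u,v) = u R̃ - v R` and `Rᵗ(u⁻¹,v) = u⁻¹ R̃ᵗ - v Rᵗ`. -/
def affLHS (F : Type) [Field F] (q : F) {N : ℕ} {A : Type} [Ring A] [Algebra F A]
    (S : ℕ → Matrix (Fin N) (Fin N) A) (a b : ℤ) :
    Matrix (Fin N × Fin N) (Fin N × Fin N) A :=
  liftF F (Rtil F q N) * z1 S (-a) * liftF F (Rtilt F q N) * z2 S (-b)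
    - liftF F (Rtil F q N) * z1 S (1 - a) * liftF F (Rct F q N) * z2 S (1 - b)
    - liftF F (Rc F q N) * z1 S (-1 - a) * liftF F (Rtilt F q N) * z2 S (1 - b)
    + liftF F (Rc F q N) * z1 S (-a) * liftF F (Rct F q N) * z2 S (2 - b)

/-- Coefficient of `u^a v^b` in `S₂(v) Rᵗ(u⁻¹,v) S₁(u) R(u,v)`. -/
def affRHS (F : Type) [Field F] (q : F) {N : ℕ} {A : Type} [Ring A] [Algebra F A]
    (S : ℕ → Matrix (Fin N) (Fin N) A) (a b : ℤ) :
    Matrix (Fin N × Fin N) (Fin N × Fin N) A :=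
  z2 S (-b) * liftF F (Rtilt F q N) * z1 S (-a) * liftF F (Rtil F q N)
    - z2 S (1 - b) * liftF F (Rtilt F q N) * z1 S (-1 - a) * liftF F (Rc F q N)
    - z2 S (1 - b) * liftF F (Rct F q N) * z1 S (1 - a) * liftF F (Rtil F q N)
    + z2 S (2 - b) * liftF F (Rct F q N) * z1 S (-a) * liftF F (Rc F q N)

def SfreeA (F : Type) [Field F] (N : ℕ) (r : ℕ) :
    Matrix (Fin N) (Fin N) (FreeAlgebra F (ℕ × Fin N × Fin N)) :=
  Matrix.of fun i j => FreeAlgebra.ι F (r, i, j)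

/-- Defining relations: only the affine reflection equation (coefficientwise). -/
inductive Rel9 (F : Type) [Field F] (q : F) (N : ℕ) :
    FreeAlgebra F (ℕ × Fin N × Fin N) → FreeAlgebra F (ℕ × Fin N × Fin N) → Prop
  | refl (a b : ℤ) (p r : Fin N × Fin N) :
      Rel9 F q N (affLHS F q (SfreeA F N) a b p r) (affRHS F q (SfreeA F N) a b p r)

abbrev Alg9 (F : Type) [Field F] (q : F) (N : ℕ) := RingQuot (Rel9 F q N)

def s9 (F : Type) [Field F] (q : F) (N : ℕ) (r : ℕ) (i j : Fin N) : Alg9 F q N :=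
  RingQuot.mkAlgHom F (Rel9 F q N) (FreeAlgebra.ι F (r, i, j))

/-- Defining relations of the presented twisted q-Yangian (orthogonal case). -/
inductive AORel (F : Type) [Field F] (q : F) (N : ℕ) :
    FreeAlgebra F (ℕ × Fin N × Fin N) → FreeAlgebra F (ℕ × Fin N × Fin N) → Prop
  | tri (i j : Fin N) (h : i < j) : AORel F q N (FreeAlgebra.ι F (0, i, j)) 0
  | diag (i : Fin N) : AORel F q N (FreeAlgebra.ι F (0, i, i)) 1
  | refl (a b : ℤ) (p r : Fin N × Fin N) :
      AORel F q N (affLHS F q (SfreeA F N) a b p r) (affRHS F q (SfreeA F N) a b p r)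

abbrev AlgAO (F : Type) [Field F] (q : F) (N : ℕ) := RingQuot (AORel F q N)

def sAO (F : Type) [Field F] (q : F) (N : ℕ) (r : ℕ) (i j : Fin N) : AlgAO F q N :=
  RingQuot.mkAlgHom F (AORel F q N) (FreeAlgebra.ι F (r, i, j))

/-- Lexicographic (non-strict) comparison of triples. -/
def tripLe (x y : ℕ × ℕ × ℕ) : Prop :=
  x.1 < y.1 ∨ (x.1 = y.1 ∧ (x.2.1 < y.2.1 ∨ (x.2.1 = y.2.1 ∧ x.2.2 ≤ y.2.2)))

/-- A list of generator indices `(r,i,j)` is ordered if it is weakly increasing with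
respect to the lexicographic order on `(r,i,j)`. -/
def sortedGens {N : ℕ} (l : List (ℕ × Fin N × Fin N)) : Prop :=
  l.Chain' fun x y => tripLe (x.1, x.2.1.val, x.2.2.val) (y.1, y.2.1.val, y.2.2.val)

/-! The quantum affine algebra `U_q(ĝl_N)` by its RTT presentation, coefficientwise. -/

abbrev AffGen (N : ℕ) := (ℕ × Fin N × Fin N) ⊕ (ℕ × Fin N × Fin N)

def TfA (F : Type) [Field F] (N : ℕ) (r : ℕ) :
    Matrix (Fin N) (Fin N) (FreeAlgebra F (AffGen N)) :=
  Matrix.of fun i j => FreeAlgebra.ι F (Sum.inl (r, i, j))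

def TbfA (F : Type) [Field F] (N : ℕ) (r : ℕ) :
    Matrix (Fin N) (Fin N) (FreeAlgebra F (AffGen N)) :=
  Matrix.of fun i j => FreeAlgebra.ι F (Sum.inr (r, i, j))

/-- Coefficient of `u^a v^b` in `R(u,v) X₁ Y₂` with prescribed coefficient extractions. -/
def affRttL (F : Type) [Field F] (q : F) {N : ℕ} {A : Type} [Ring A] [Algebra F A]
    (X Y : ℕ → Matrix (Fin N) (Fin N) A) (a b a' b' : ℤ) :
    Matrix (Fin N × Fin N) (Fin N × Fin N) A :=
  liftF F (Rtil F q N) * z1 X a * z2 Y b - liftF F (Rc F q N) * z1 X a' * z2 Y b'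

def affRttR (F : Type) [Field F] (q : F) {N : ℕ} {A : Type} [Ring A] [Algebra F A]
    (X Y : ℕ → Matrix (Fin N) (Fin N) A) (a b a' b' : ℤ) :
    Matrix (Fin N × Fin N) (Fin N × Fin N) A :=
  z2 Y b * z1 X a * liftF F (Rtil F q N) - z2 Y b' * z1 X a' * liftF F (Rc F q N)

inductive AffGlRel (F : Type) [Field F] (q : F) (N : ℕ) :
    FreeAlgebra F (AffGen N) → FreeAlgebra F (AffGen N) → Prop
  | t0_tri (i j : Fin N) (h : i < j) : AffGlRel F q N (TfA F N 0 i j) 0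
  | tb0_tri (i j : Fin N) (h : j < i) : AffGlRel F q N (TbfA F N 0 i j) 0
  | t_tb (i : Fin N) : AffGlRel F q N (TfA F N 0 i i * TbfA F N 0 i i) 1
  | tb_t (i : Fin N) : AffGlRel F q N (TbfA F N 0 i i * TfA F N 0 i i) 1
  | rtt (a b : ℤ) (p r : Fin N × Fin N) :
      AffGlRel F q N
        (affRttL F q (TfA F N) (TfA F N) (1 - a) (-b) (-a) (1 - b) p r)
        (affRttR F q (TfA F N) (TfA F N) (1 - a) (-b) (-a) (1 - b) p r)
  | rtbtb (a b : ℤ) (p r : Fin N × Fin N) :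
      AffGlRel F q N
        (affRttL F q (TbfA F N) (TbfA F N) (a - 1) b a (b - 1) p r)
        (affRttR F q (TbfA F N) (TbfA F N) (a - 1) b a (b - 1) p r)
  | rtbt (a b : ℤ) (p r : Fin N × Fin N) :
      AffGlRel F q N
        (affRttL F q (TbfA F N) (TfA F N) (a - 1) (-b) a (1 - b) p r)
        (affRttR F q (TbfA F N) (TfA F N) (a - 1) (-b) a (1 - b) p r)

/-- The quantum affine algebra `U_q(ĝl_N)`. -/
abbrev UqAff (F : Type) [Field F] (q : F) (N : ℕ) := RingQuot (AffGlRel F q N)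

def tA (F : Type) [Field F] (q : F) (N : ℕ) (r : ℕ) (i j : Fin N) : UqAff F q N :=
  RingQuot.mkAlgHom F (AffGlRel F q N) (FreeAlgebra.ι F (Sum.inl (r, i, j)))

def tbA (F : Type) [Field F] (q : F) (N : ℕ) (r : ℕ) (i j : Fin N) : UqAff F q N :=
  RingQuot.mkAlgHom F (AffGlRel F q N) (FreeAlgebra.ι F (Sum.inr (r, i, j)))

/-- Coefficient of `u^{-r}` in `s_ij(u) = Σ_a t_ia(u) t̄_ja(u⁻¹)`. -/
def Scoef (F : Type) [Field F] (q : F) (N : ℕ) (r : ℕ) (i j : Fin N) : UqAff F q N :=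
  ∑ a : Fin N, ∑ p ∈ Finset.range (r + 1), tA F q N p i a * tbA F q N (r - p) j a

/-- The twisted q-Yangian `Y^tw_q(o_N)` as a subalgebra of `U_q(ĝl_N)`. -/
def YtwO (F : Type) [Field F] (q : F) (N : ℕ) : Subalgebra F (UqAff F q N) :=
  Algebra.adjoin F {x | ∃ r i j, x = Scoef F q N r i j}

/-- Coefficient of `u^{-r}` in `s_ij(u)`, the `(i,j)` entry of `S(u) = T(u) G T̄(u⁻¹)ᵗ`
in the symplectic case. -/
def ScoefSp (F : Type) [Field F] (q : F) (n : ℕ) (r : ℕ) (i j : Fin (2 * n)) :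
    UqAff F q (2 * n) :=
  ∑ a : Fin n, ∑ p ∈ Finset.range (r + 1),
    (algebraMap F _ q * (tA F q (2 * n) p i (fe n a) * tbA F q (2 * n) (r - p) j (fo n a))
      - tA F q (2 * n) p i (fo n a) * tbA F q (2 * n) (r - p) j (fe n a))

/-- The twisted q-Yangian `Y^tw_q(sp_2n)` as a subalgebra of `U_q(ĝl_2n)`,
with a prescribed family of inverses of `s^{(0)}_{ii'}`. -/
def YtwSp (F : Type) [Field F] (q : F) (n : ℕ) (inv : Fin n → UqAff F q (2 * n)) :
    Subalgebra F (UqAff F q (2 * n)) :=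
  Algebra.adjoin F ({x | ∃ r i j, x = ScoefSp F q n r i j} ∪ Set.range inv)

abbrev ASpGen (n : ℕ) := (ℕ × Fin (2 * n) × Fin (2 * n)) ⊕ Fin n

def SfreeASp (F : Type) [Field F] (n : ℕ) (r : ℕ) :
    Matrix (Fin (2 * n)) (Fin (2 * n)) (FreeAlgebra F (ASpGen n)) :=
  Matrix.of fun i j => FreeAlgebra.ι F (Sum.inl (r, i, j))

/-- Defining relations of the presented twisted q-Yangian (symplectic case). -/
inductive ASpRel (F : Type) [Field F] (q : F) (n : ℕ) :
    FreeAlgebra F (ASpGen n) → FreeAlgebra F (ASpGen n) → Prop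
  | tri (i j : Fin (2 * n)) (h : i < j) (h' : ¬(i.val % 2 = 0 ∧ j.val = i.val + 1)) :
      ASpRel F q n (FreeAlgebra.ι F (Sum.inl (0, i, j))) 0
  | quad (k : Fin n) :
      ASpRel F q n
        (FreeAlgebra.ι F (Sum.inl (0, fo n k, fo n k)) *
          FreeAlgebra.ι F (Sum.inl (0, fe n k, fe n k)))
        (algebraMap F _ (q ^ 2) *
            (FreeAlgebra.ι F (Sum.inl (0, fo n k, fe n k)) *
              FreeAlgebra.ι F (Sum.inl (0, fe n k, fo n k)))
          + algebraMap F _ (q ^ 3))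
  | invR (k : Fin n) :
      ASpRel F q n
        (FreeAlgebra.ι F (Sum.inl (0, fe n k, fo n k)) * FreeAlgebra.ι F (Sum.inr k)) 1
  | invL (k : Fin n) :
      ASpRel F q n
        (FreeAlgebra.ι F (Sum.inr k) * FreeAlgebra.ι F (Sum.inl (0, fe n k, fo n k))) 1
  | refl (a b : ℤ) (p r : Fin (2 * n) × Fin (2 * n)) :
      ASpRel F q n (affLHS F q (SfreeASp F n) a b p r) (affRHS F q (SfreeASp F n) a b p r)

abbrev AlgASp (F : Type) [Field F] (q : F) (n : ℕ) := RingQuot (ASpRel F q n)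

def sASp (F : Type) [Field F] (q : F) (n : ℕ) (r : ℕ) (i j : Fin (2 * n)) : AlgASp F q n :=
  RingQuot.mkAlgHom F (ASpRel F q n) (FreeAlgebra.ι F (Sum.inl (r, i, j)))

def sInvASp (F : Type) [Field F] (q : F) (n : ℕ) (k : Fin n) : AlgASp F q n :=
  RingQuot.mkAlgHom F (ASpRel F q n) (FreeAlgebra.ι F (Sum.inr k))

/-! q-antisymmetrizer and Sklyanin/quantum determinant machinery. -/

/-- The trigonometric R-matrix `R(u,v)`. -/
def Rtrig (F : Type) [Field F] (q : F) (N : ℕ) (u v : F) :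
    Matrix (Fin N × Fin N) (Fin N × Fin N) F := Matrix.of fun p r =>
  (if p = r then (if p.1 = p.2 then q⁻¹ * u - q * v else u - v) else 0)
  + (if p.1 = r.2 ∧ p.2 = r.1 ∧ p.1 ≠ p.2 then
      (q⁻¹ - q) * (if p.2 < p.1 then u else v) else 0)

/-- An operator on `ℂ^N ⊗ ℂ^N` acting in the `i`-th and `j`-th factors of `(ℂ^N)^{⊗ r}`. -/
def big2 (F : Type) [Field F] {N r : ℕ} (i j : Fin r)
    (M : Matrix (Fin N × Fin N) (Fin N × Fin N) F) :
    Matrix (Fin r → Fin N) (Fin r → Fin N) F :=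
  Matrix.of fun f g =>
    if ∀ k, k ≠ i → k ≠ j → f k = g k then M (f i, f j) (g i, g j) else 0

/-- The list of the pairs `(i,j)`, `i < j`, in lexicographic order. -/
def pairsLex (r : ℕ) : List (Fin r × Fin r) :=
  (List.finRange r).flatMap fun i =>
    ((List.finRange r).filter fun j => i < j).map fun j => (i, j)

/-- The number of inversions (the Coxeter length) of a permutation. -/
def invCount {r : ℕ} (σ : Equiv.Perm (Fin r)) : ℕ :=
  (Finset.univ.filter fun p : Fin r × Fin r => p.1 < p.2 ∧ σ p.2 < σ p.1).card

/-- The q-permutation operator `P^q` on `ℂ^N ⊗ ℂ^N`. -/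
def PqSmall (F : Type) [Field F] (q : F) (N : ℕ) :
    Matrix (Fin N × Fin N) (Fin N × Fin N) F := Matrix.of fun p r =>
  if r.1 = p.2 ∧ r.2 = p.1 then (if p.1 = p.2 then 1 else if p.2 < p.1 then q else q⁻¹)
  else 0

/-- The hypothesis that `Pq` is the extension of the q-permutation operators along
reduced decompositions: `P^q_{σ s_i} = P^q_σ P^q_{s_i}` whenever the length grows. -/
def PqExt (F : Type) [Field F] (q : F) (N r : ℕ)
    (Pq : Equiv.Perm (Fin r) → Matrix (Fin r → Fin N) (Fin r → Fin N) F) : Prop :=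
  Pq 1 = 1 ∧
    ∀ (σ : Equiv.Perm (Fin r)) (i : ℕ) (h : i + 1 < r),
      invCount (σ * Equiv.swap ⟨i, Nat.lt_of_succ_lt h⟩ ⟨i + 1, h⟩) = invCount σ + 1 →
        Pq (σ * Equiv.swap ⟨i, Nat.lt_of_succ_lt h⟩ ⟨i + 1, h⟩) =
          Pq σ * big2 F ⟨i, Nat.lt_of_succ_lt h⟩ ⟨i + 1, h⟩ (PqSmall F q N)

/-- The q-antisymmetrizer `A^q_r = Σ_σ sgn(σ) P^q_σ`. -/
def AqM (F : Type) [Field F] {N r : ℕ}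
    (Pq : Equiv.Perm (Fin r) → Matrix (Fin r → Fin N) (Fin r → Fin N) F) :
    Matrix (Fin r → Fin N) (Fin r → Fin N) F :=
  ∑ σ : Equiv.Perm (Fin r), ((Equiv.Perm.sign σ : ℤ) : F) • Pq σ

/-- A matrix acting in the `k`-th factor of `(ℂ^N)^{⊗ N}`, with entries in `A`. -/
def ampAt {A : Type} [Ring A] {N : ℕ} (k : Fin N) (M : Matrix (Fin N) (Fin N) A) :
    Matrix (Fin N → Fin N) (Fin N → Fin N) A :=
  Matrix.of fun f g => if ∀ l, l ≠ k → f l = g l then M (f k) (g k) else 0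

/-- A scalar two-site operator viewed over `A`, acting at sites `i`, `j`. -/
def big2A (F : Type) [Field F] {A : Type} [Ring A] [Algebra F A] {N : ℕ} (i j : Fin N)
    (M : Matrix (Fin N × Fin N) (Fin N × Fin N) F) :
    Matrix (Fin N → Fin N) (Fin N → Fin N) A :=
  (big2 F i j M).map (algebraMap F A)

/-- Coefficient of `u^m` in a product of formal series, each of which is supported in
degrees `≤ 1`; the series are given by their coefficient functions `ℤ → M`. -/
def seriesProdCoeff {M : Type} [Ring M] : List (ℤ → M) → ℤ → M
  | [], m => if m = 0 then 1 else 0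
  | c :: t, m => ∑ k ∈ Finset.Icc (m - t.length) 1, c k * seriesProdCoeff t (m - k)

/-! Series factors entering the Sklyanin determinant. -/

/-- The matrix `S^{(r)}` of the coefficients of `S(u)` (orthogonal case). -/
def SmatA (F : Type) [Field F] (q : F) (N : ℕ) (r : ℕ) :
    Matrix (Fin N) (Fin N) (UqAff F q N) :=
  Matrix.of fun i j => Scoef F q N r i j

/-- The series `S_k(q^{-2k+2} u)` acting at site `k` (0-based `k`), coefficientwise. -/
def SfacO (F : Type) [Field F] (q : F) (N : ℕ) (k : Fin N) (m : ℤ) :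
    Matrix (Fin N → Fin N) (Fin N → Fin N) (UqAff F q N) :=
  if m ≤ 0 then q ^ (2 * (k.val : ℤ) * (-m)) • ampAt k (SmatA F q N (-m).toNat) else 0

/-- The series `R_{ij}ᵗ((q^{-2i+2}u)⁻¹, q^{-2j+2}u)` (0-based `i`, `j`), coefficientwise. -/
def RtfacO (F : Type) [Field F] (q : F) (N : ℕ) (i j : Fin N) (m : ℤ) :
    Matrix (Fin N → Fin N) (Fin N → Fin N) (UqAff F q N) :=
  if m = -1 then q ^ (2 * (i.val : ℤ)) • big2A F i j (Rtilt F q N)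
  else if m = 1 then (-(q ^ (-2 * (j.val : ℤ)))) • big2A F i j (Rct F q N)
  else 0

/-- The ordered list of factors `S₁(u) R₁₂ᵗ ⋯ R₁Nᵗ S₂(q⁻²u) ⋯ S_N(q^{-2N+2}u)`. -/
def sdetFacsO (F : Type) [Field F] (q : F) (N : ℕ) :
    List (ℤ → Matrix (Fin N → Fin N) (Fin N → Fin N) (UqAff F q N)) :=
  (List.finRange N).flatMap fun i =>
    SfacO F q N i :: (((List.finRange N).filter fun j => i < j).map fun j => RtfacO F q N i j)

/-- The matrix `S^{(r)}` of the coefficients of `S(u)` (symplectic case). -/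
def SmatASp (F : Type) [Field F] (q : F) (n : ℕ) (r : ℕ) :
    Matrix (Fin (2 * n)) (Fin (2 * n)) (UqAff F q (2 * n)) :=
  Matrix.of fun i j => ScoefSp F q n r i j

def SfacSp (F : Type) [Field F] (q : F) (n : ℕ) (k : Fin (2 * n)) (m : ℤ) :
    Matrix (Fin (2 * n) → Fin (2 * n)) (Fin (2 * n) → Fin (2 * n)) (UqAff F q (2 * n)) :=
  if m ≤ 0 then q ^ (2 * (k.val : ℤ) * (-m)) • ampAt k (SmatASp F q n (-m).toNat) else 0

def sdetFacsSp (F : Type) [Field F] (q : F) (n : ℕ) :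
    List (ℤ → Matrix (Fin (2 * n) → Fin (2 * n)) (Fin (2 * n) → Fin (2 * n))
      (UqAff F q (2 * n))) :=
  (List.finRange (2 * n)).flatMap fun i =>
    SfacSp F q n i ::
      (((List.finRange (2 * n)).filter fun j => i < j).map fun j => RtfacO F q (2 * n) i j)

/-- Coefficientwise quantum determinant `qdet T(u)`:
the coefficient of `u^m` (nonzero only for `m ≤ 0`). -/
def qdetTc (F : Type) [Field F] (q : F) (N : ℕ) (m : ℤ) : UqAff F q N :=
  if m ≤ 0 then
    ∑ σ : Equiv.Perm (Fin N), ∑ rv ∈ Finset.Nat.antidiagonalTuple N (-m).toNat,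
      (((-q)⁻¹ ^ invCount σ) * ∏ k : Fin N, q ^ (2 * (k.val : ℤ) * (rv k : ℤ))) •
        ((List.finRange N).map fun k => tA F q N (rv k) (σ k) k).prod
  else 0

/-- Coefficientwise quantum determinant `qdet T̄(q^{2N-2} u⁻¹)`:
the coefficient of `u^m` (nonzero only for `m ≤ 0`). -/
def qdetTbc (F : Type) [Field F] (q : F) (N : ℕ) (m : ℤ) : UqAff F q N :=
  if m ≤ 0 then
    ∑ σ : Equiv.Perm (Fin N), ∑ rv ∈ Finset.Nat.antidiagonalTuple N (-m).toNat,
      (((-q)⁻¹ ^ invCount σ) *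
          ∏ k : Fin N, q ^ ((2 * (N : ℤ) - 2 - 2 * (k.val : ℤ)) * (rv k : ℤ))) •
        ((List.finRange N).map fun k => tbA F q N (rv k) (σ k) k).prod
  else 0

/-- The linear factor `q^{2i-2}u⁻¹ - q^{-2j+2}u` of `γ_N(u)` (0-based `i`, `j`),
viewed as an `A`-valued series. -/
def gamFac (F : Type) [Field F] (q : F) (N : ℕ) (p : Fin N × Fin N) (m : ℤ) : UqAff F q N :=
  if m = -1 then algebraMap F _ (q ^ (2 * (p.1.val : ℤ)))
  else if m = 1 then algebraMap F _ (-(q ^ (-2 * (p.2.val : ℤ)))) else 0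

/-- The list of series whose product is `γ_N(u) qdet T(u) qdet T̄(q^{2N-2}u⁻¹)`
in the orthogonal case. -/
def rhsO (F : Type) [Field F] (q : F) (N : ℕ) : List (ℤ → UqAff F q N) :=
  ((pairsLex N).map fun p => gamFac F q N p) ++ [qdetTc F q N, qdetTbc F q N]

section Generators

variable {F : Type} [Field F] {q : F} {N n : ℕ}

theorem tE_eq_zero {i j : Fin N} (h : i < j) : tE F q N i j = 0 := by
  simpa [tE, Tfree] using RingQuot.mkAlgHom_rel F (GlRel.t_zero (F := F) (q := q) i j h)

theorem tbE_eq_zero {i j : Fin N} (h : j < i) : tbE F q N i j = 0 := by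
  simpa [tbE, Tbfree] using RingQuot.mkAlgHom_rel F (GlRel.tb_zero (F := F) (q := q) i j h)

theorem tE_mul_tbE (i : Fin N) : tE F q N i i * tbE F q N i i = 1 := by
  simpa [tE, tbE, Tfree, Tbfree] using
    RingQuot.mkAlgHom_rel F (GlRel.t_tb (F := F) (q := q) i)

theorem tbE_mul_tE (i : Fin N) : tbE F q N i i * tE F q N i i = 1 := by
  simpa [tE, tbE, Tfree, Tbfree] using
    RingQuot.mkAlgHom_rel F (GlRel.tb_t (F := F) (q := q) i)

/-- `s_kl` vanishes when `k ≤ i`, `i' ≤ l` and `(k, l) ≠ (i, i')`. -/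
theorem sSp_eq_zero {m : Fin n} {k l : Fin (2 * n)} (hk : k ≤ fe n m) (hl : fo n m ≤ l)
    (h : k ≠ fe n m ∨ l ≠ fo n m) : sSp F q n k l = 0 := by
  have hk' : k.val ≤ 2 * m.val := hk
  have hl' : 2 * m.val + 1 ≤ l.val := hl
  have h' : k.val ≠ 2 * m.val ∨ l.val ≠ 2 * m.val + 1 := by
    simpa [Fin.ext_iff, fe, fo] using h
  have h₁ : ∀ a : Fin n, tE F q (2 * n) k (fe n a) * tbE F q (2 * n) l (fo n a) = 0 := by
    intro a
    by_cases hka : k < fe n a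
    · rw [tE_eq_zero hka, zero_mul]
    · rw [tbE_eq_zero, mul_zero]
      simp only [Fin.lt_def, fe, fo] at hka ⊢
      omega
  have h₂ : ∀ a : Fin n, tE F q (2 * n) k (fo n a) * tbE F q (2 * n) l (fe n a) = 0 := by
    intro a
    by_cases hka : k < fo n a
    · rw [tE_eq_zero hka, zero_mul]
    · rw [tbE_eq_zero, mul_zero]
      simp only [Fin.lt_def, fe, fo] at hka ⊢
      omega
  simp [sSp, h₁, h₂]

variable {Δ : UqGl F q (2 * n) →ₐ[F] TensorProduct F (UqGl F q (2 * n)) (UqGl F q (2 * n))}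

theorem coproduct_tE_mul_tbE
    (hΔt : ∀ i j : Fin (2 * n), Δ (tE F q (2 * n) i j) =
      ∑ k : Fin (2 * n), tE F q (2 * n) i k ⊗ₜ[F] tE F q (2 * n) k j)
    (hΔtb : ∀ i j : Fin (2 * n), Δ (tbE F q (2 * n) i j) =
      ∑ k : Fin (2 * n), tbE F q (2 * n) i k ⊗ₜ[F] tbE F q (2 * n) k j)
    (i j a b : Fin (2 * n)) :
    Δ (tE F q (2 * n) i a * tbE F q (2 * n) j b) =
      ∑ k : Fin (2 * n), ∑ l : Fin (2 * n),
        (tE F q (2 * n) i k * tbE F q (2 * n) j l) ⊗ₜ[F]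
          (tE F q (2 * n) k a * tbE F q (2 * n) l b) := by
  rw [map_mul, hΔt, hΔtb, Finset.sum_mul_sum]
  simp only [Algebra.TensorProduct.tmul_mul_tmul]

theorem coproduct_sSp
    (hΔt : ∀ i j : Fin (2 * n), Δ (tE F q (2 * n) i j) =
      ∑ k : Fin (2 * n), tE F q (2 * n) i k ⊗ₜ[F] tE F q (2 * n) k j)
    (hΔtb : ∀ i j : Fin (2 * n), Δ (tbE F q (2 * n) i j) =
      ∑ k : Fin (2 * n), tbE F q (2 * n) i k ⊗ₜ[F] tbE F q (2 * n) k j)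
    (i j : Fin (2 * n)) :
    Δ (sSp F q n i j) = ∑ k : Fin (2 * n), ∑ l : Fin (2 * n),
      (tE F q (2 * n) i k * tbE F q (2 * n) j l) ⊗ₜ[F] sSp F q n k l := by
  have comm : ∀ f : Fin n → Fin (2 * n) → Fin (2 * n) →
      TensorProduct F (UqGl F q (2 * n)) (UqGl F q (2 * n)),
      ∑ a, ∑ k, ∑ l, f a k l = ∑ k, ∑ l, ∑ a, f a k l := by
    intro f
    rw [Finset.sum_comm]
    exact Finset.sum_congr rfl fun k _ => Finset.sum_comm
  have sub : ∀ f g : Fin (2 * n) → Fin (2 * n) →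
      TensorProduct F (UqGl F q (2 * n)) (UqGl F q (2 * n)),
      ∑ k, ∑ l, f k l - ∑ k, ∑ l, g k l = ∑ k, ∑ l, (f k l - g k l) := by
    intro f g
    refine Eq.trans ?_ (Finset.sum_congr rfl fun k _ =>
      (Finset.sum_sub_distrib (s := Finset.univ) (f k) (g k)).symm)
    exact (Finset.sum_sub_distrib (s := Finset.univ) (fun k => ∑ l, f k l)
      (fun k => ∑ l, g k l)).symm
  simp only [sSp, ← Algebra.smul_def, map_sub, map_smul, map_sum,
    coproduct_tE_mul_tbE hΔt hΔtb, comm, TensorProduct.tmul_sub, TensorProduct.tmul_smul,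
    TensorProduct.tmul_sum, Finset.smul_sum]
  exact sub _ _

theorem coproduct_sSp_fe_fo
    (hΔt : ∀ i j : Fin (2 * n), Δ (tE F q (2 * n) i j) =
      ∑ k : Fin (2 * n), tE F q (2 * n) i k ⊗ₜ[F] tE F q (2 * n) k j)
    (hΔtb : ∀ i j : Fin (2 * n), Δ (tbE F q (2 * n) i j) =
      ∑ k : Fin (2 * n), tbE F q (2 * n) i k ⊗ₜ[F] tbE F q (2 * n) k j)
    (m : Fin n) :
    Δ (sSp F q n (fe n m) (fo n m)) =
      (tE F q (2 * n) (fe n m) (fe n m) * tbE F q (2 * n) (fo n m) (fo n m)) ⊗ₜ[F]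
        sSp F q n (fe n m) (fo n m) := by
  have vanish : ∀ k l : Fin (2 * n), k ≠ fe n m ∨ l ≠ fo n m →
      (tE F q (2 * n) (fe n m) k * tbE F q (2 * n) (fo n m) l) ⊗ₜ[F] sSp F q n k l = 0 := by
    intro k l h
    by_cases hk : fe n m < k
    · rw [tE_eq_zero hk, zero_mul, TensorProduct.zero_tmul]
    by_cases hl : l < fo n m
    · rw [tbE_eq_zero hl, mul_zero, TensorProduct.zero_tmul]
    rw [sSp_eq_zero (not_lt.mp hk) (not_lt.mp hl) h, TensorProduct.tmul_zero]
  rw [coproduct_sSp hΔt hΔtb, Finset.sum_eq_single (fe n m), Finset.sum_eq_single (fo n m)]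
  · exact fun l _ hl => vanish _ l (Or.inr hl)
  · simp
  · exact fun k _ hk => Finset.sum_eq_zero fun l _ => vanish k l (Or.inl hk)
  · simp

end Generators

/-- If an algebra homomorphism `Δ` maps a set `s` into the image of `A ⊗ B` in `A ⊗ A`, then it
maps the whole subalgebra generated by `s` into that image. -/
theorem map_mem_range_map_of_mem_adjoin {F A C : Type*} [CommRing F] [Ring A] [Algebra F A]
    [Ring C] [Algebra F C] (B : Subalgebra F A) (Δ : C →ₐ[F] TensorProduct F A A) {s : Set C}
    (hs : ∀ x ∈ s, Δ x ∈ LinearMap.range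
      (TensorProduct.map (LinearMap.id : A →ₗ[F] A) (Subalgebra.toSubmodule B).subtype))
    {x : C} (hx : x ∈ Algebra.adjoin F s) :
    Δ x ∈ LinearMap.range
      (TensorProduct.map (LinearMap.id : A →ₗ[F] A) (Subalgebra.toSubmodule B).subtype) :=
  have h : Algebra.adjoin F s ≤
      (Algebra.TensorProduct.map (AlgHom.id F A) B.val).range.comap Δ :=
    Algebra.adjoin_le hs
  h hx

/-- `Δ(s_ij) = Σ_{k,l} t_ik t̄_jl ⊗ s_kl` and
`Δ(s_{ii'}^{-1}) = t_{i'i'} t̄_ii ⊗ s_{ii'}^{-1}`, hence `U^tw_q(sp_2n)` is a left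
coideal of `U_q(gl_2n)`. -/
theorem stmt8 (n : ℕ)
    (Δ : UqGl FF qq (2 * n) →ₐ[FF]
      TensorProduct FF (UqGl FF qq (2 * n)) (UqGl FF qq (2 * n)))
    (hΔt : ∀ i j : Fin (2 * n), Δ (tE FF qq (2 * n) i j) =
      ∑ k : Fin (2 * n), tE FF qq (2 * n) i k ⊗ₜ[FF] tE FF qq (2 * n) k j)
    (hΔtb : ∀ i j : Fin (2 * n), Δ (tbE FF qq (2 * n) i j) =
      ∑ k : Fin (2 * n), tbE FF qq (2 * n) i k ⊗ₜ[FF] tbE FF qq (2 * n) k j)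
    (inv : Fin n → UqGl FF qq (2 * n))
    (hinv : ∀ k : Fin n,
      sSp FF qq n (fe n k) (fo n k) * inv k = 1 ∧
        inv k * sSp FF qq n (fe n k) (fo n k) = 1) :
    (∀ i j : Fin (2 * n), Δ (sSp FF qq n i j) =
        ∑ k : Fin (2 * n), ∑ l : Fin (2 * n),
          (tE FF qq (2 * n) i k * tbE FF qq (2 * n) j l) ⊗ₜ[FF] sSp FF qq n k l) ∧
      (∀ k : Fin n, Δ (inv k) =
        (tE FF qq (2 * n) (fo n k) (fo n k) * tbE FF qq (2 * n) (fe n k) (fe n k))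
          ⊗ₜ[FF] inv k) ∧
      ∀ x ∈ Algebra.adjoin FF ({x | ∃ i j, x = sSp FF qq n i j} ∪ Set.range inv),
        Δ x ∈ LinearMap.range
          (TensorProduct.map
            (LinearMap.id : UqGl FF qq (2 * n) →ₗ[FF] UqGl FF qq (2 * n))
            (Subalgebra.toSubmodule
              (Algebra.adjoin FF
                ({x | ∃ i j, x = sSp FF qq n i j} ∪ Set.range inv))).subtype) := by
  have hΔinv : ∀ k : Fin n, Δ (inv k) =
      (tE FF qq (2 * n) (fo n k) (fo n k) * tbE FF qq (2 * n) (fe n k) (fe n k))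
        ⊗ₜ[FF] inv k := by
    intro k
    refine left_inv_eq_right_inv (a := Δ (sSp FF qq n (fe n k) (fo n k))) ?_ ?_
    · rw [← map_mul, (hinv k).2, map_one]
    · rw [coproduct_sSp_fe_fo hΔt hΔtb, Algebra.TensorProduct.tmul_mul_tmul, (hinv k).1,
        mul_assoc, ← mul_assoc (tbE FF qq (2 * n) (fo n k) (fo n k)), tbE_mul_tE, one_mul,
        tE_mul_tbE, Algebra.TensorProduct.one_def]
  refine ⟨coproduct_sSp hΔt hΔtb, hΔinv, fun x hx =>
    map_mem_range_map_of_mem_adjoin _ Δ ?_ hx⟩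
  rintro _ (⟨i, j, rfl⟩ | ⟨k, rfl⟩)
  · rw [coproduct_sSp hΔt hΔtb]
    refine Submodule.sum_mem _ fun k _ => Submodule.sum_mem _ fun l _ => ?_
    exact ⟨_ ⊗ₜ ⟨sSp FF qq n k l, Algebra.subset_adjoin (Or.inl ⟨k, l, rfl⟩)⟩, rfl⟩
  · rw [hΔinv]
    exact ⟨_ ⊗ₜ ⟨inv k, Algebra.subset_adjoin (Or.inr ⟨k, rfl⟩)⟩, rfl⟩
end
end

section
/- Consider the associative algebra with generators s_ij^{(r)} (1 ≤ i,j ≤ N, r ≥ 0) whose defining relations are encoded by the affine reflection equation R(u,v) S₁(u) Rᵗ(u⁻¹,v) S₂(v) = S₂(v) Rᵗ(u⁻¹,v) S₁(u) R(u,v) for the series S(u) = Σ_{i,j} s_ij(u)⊗E_ij with s_ij(u) = Σ_{r≥0} s_ij^{(r)} u^{−r}. Order the generators by s_ij^{(r)} ⪯ s_kl^{(p)} if and only if (r,i,j) ⪯ (p,k,l) lexicographically. Then the ordered monomials in the generators linearly span the algebra. -/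
noncomputable section

open scoped TensorProduct

section ReflectionAlgebra

variable {F : Type} [Field F] {q : F} {N : ℕ} {A : Type} [Ring A] [Algebra F A]

/-- Matrices acting on the tensor square. -/
abbrev Mat2 (N : ℕ) (A : Type) : Type := Matrix (Fin N × Fin N) (Fin N × Fin N) A

/-- A sequence of matrices extended by zero to integer indices. -/
def extZ (S : ℕ → Matrix (Fin N) (Fin N) A) (r : ℤ) : Matrix (Fin N) (Fin N) A :=
  if 0 ≤ r then S r.toNat else 0

theorem z1_eq_amp1 (S : ℕ → Matrix (Fin N) (Fin N) A) (r : ℤ) : z1 S r = amp1 (extZ S r) := by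
  unfold z1 extZ
  split_ifs
  · rfl
  · ext p s
    simp [amp1]

theorem z2_eq_amp2 (S : ℕ → Matrix (Fin N) (Fin N) A) (r : ℤ) : z2 S r = amp2 (extZ S r) := by
  unfold z2 extZ
  split_ifs
  · rfl
  · ext p s
    simp [amp2]

/-- The entries of `X₁ Rᵗ Y₂`. -/
def sandwich (q : F) (X Y : Matrix (Fin N) (Fin N) A) (i j a b : Fin N) : A :=
  (if a = j then q else 1) • (X i a * Y j b) +
    (if a < j then q - q⁻¹ else 0) • (X i j * Y a b)

theorem amp1_mul_liftF_mul_amp2_apply (M : Mat2 N F)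
    (X Y : Matrix (Fin N) (Fin N) A) (i j a b : Fin N) :
    (amp1 X * liftF F M * amp2 Y : Mat2 N A) (i, j) (a, b) =
      ∑ l, ∑ k, M (k, j) (a, l) • (X i k * Y l b) := by
  simp only [Matrix.mul_apply, Fintype.sum_prod_type, amp1, amp2, liftF, Matrix.of_apply,
    Matrix.map_apply, ite_mul, mul_ite, zero_mul, mul_zero, Finset.sum_ite_eq, Finset.mem_univ,
    if_true, Finset.sum_mul]
  rw [Finset.sum_eq_single a]
  · refine Finset.sum_congr rfl fun l _ => ?_
    rw [if_pos rfl]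
    refine Finset.sum_congr rfl fun k _ => ?_
    rw [← Algebra.commutes, mul_assoc, Algebra.smul_def]
  · intro x _ hx
    simp [hx]
  · simp

theorem amp2_mul_liftF_mul_amp1_apply (M : Mat2 N F)
    (X Y : Matrix (Fin N) (Fin N) A) (i j a b : Fin N) :
    (amp2 X * liftF F M * amp1 Y : Mat2 N A) (i, j) (a, b) =
      ∑ l, ∑ k, M (i, k) (l, b) • (X j k * Y l a) := by
  simp only [Matrix.mul_apply, Fintype.sum_prod_type, amp1, amp2, liftF, Matrix.of_apply,
    Matrix.map_apply, ite_mul, mul_ite, zero_mul, mul_zero, Finset.sum_mul]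
  rw [Finset.sum_comm, Finset.sum_eq_single b (by aesop) (by simp)]
  refine Finset.sum_congr rfl fun l _ => ?_
  rw [if_pos rfl, Finset.sum_eq_single i (by aesop) (by simp)]
  refine Finset.sum_congr rfl fun k _ => ?_
  rw [if_pos rfl, ← Algebra.commutes, mul_assoc, Algebra.smul_def]

theorem amp1_mul_Rct_mul_amp2_apply (X Y : Matrix (Fin N) (Fin N) A) (i j a b : Fin N) :
    (amp1 X * liftF F (Rct F q N) * amp2 Y : Mat2 N A) (i, j) (a, b) = sandwich q X Y i j a b := by
  rw [amp1_mul_liftF_mul_amp2_apply]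
  simp only [Rct, Rc, sandwich, Matrix.of_apply, Prod.mk.injEq, add_smul, Finset.sum_add_distrib]
  congr 1
  · rw [Finset.sum_eq_single j (fun l _ hl => Finset.sum_eq_zero fun k _ => ?_) (by simp),
      Finset.sum_eq_single a] <;> aesop
  · rw [Finset.sum_eq_single a (fun l _ hl => Finset.sum_eq_zero fun k _ => ?_) (by simp),
      Finset.sum_eq_single j] <;> aesop

theorem amp2_mul_Rct_mul_amp1_apply (X Y : Matrix (Fin N) (Fin N) A) (i j a b : Fin N) :
    (amp2 X * liftF F (Rct F q N) * amp1 Y : Mat2 N A) (i, j) (a, b) = sandwich q X Y j i b a := by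
  rw [amp2_mul_liftF_mul_amp1_apply]
  simp only [Rct, Rc, sandwich, Matrix.of_apply, Prod.mk.injEq, add_smul, Finset.sum_add_distrib]
  congr 1
  · rw [Finset.sum_eq_single i (fun l _ hl => Finset.sum_eq_zero fun k _ => ?_) (by simp),
      Finset.sum_eq_single b] <;> aesop
  · rw [Finset.sum_eq_single b (fun l _ hl => Finset.sum_eq_zero fun k _ => ?_) (by simp),
      Finset.sum_eq_single i] <;> aesop

theorem liftF_Rc_mul_apply (M : Mat2 N A) (i j : Fin N)
    (r : Fin N × Fin N) :
    (liftF F (Rc F q N) * M : Mat2 N A) (i, j) r =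
      (if i = j then q else 1) • M (i, j) r + (if i < j then q - q⁻¹ else 0) • M (j, i) r := by
  simp only [Matrix.mul_apply, liftF, Matrix.map_apply, ← Algebra.smul_def, Rc, Matrix.of_apply,
    add_smul, Finset.sum_add_distrib]
  congr 1
  · rw [Finset.sum_eq_single (i, j)] <;> aesop
  · rw [Finset.sum_eq_single (j, i)] <;> aesop

theorem mul_liftF_Rc_apply (M : Mat2 N A) (a b : Fin N)
    (p : Fin N × Fin N) :
    (M * liftF F (Rc F q N) : Mat2 N A) p (a, b) =
      (if a = b then q else 1) • M p (a, b) + (if b < a then q - q⁻¹ else 0) • M p (b, a) := by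
  simp only [Matrix.mul_apply, liftF, Matrix.map_apply, ← Algebra.commutes, ← Algebra.smul_def,
    Rc, Matrix.of_apply, add_smul, Finset.sum_add_distrib]
  congr 1
  · rw [Finset.sum_eq_single (a, b)] <;> aesop
  · rw [Finset.sum_eq_single (b, a)] <;> aesop

/-- The relation between the two constant R-matrices: `R - R̃ = (q - q⁻¹) P`. -/
theorem Rtil_apply (p r : Fin N × Fin N) :
    Rtil F q N p r = Rc F q N p r - if r = (p.2, p.1) then q - q⁻¹ else 0 := by
  obtain ⟨i, j⟩ := p
  obtain ⟨a, b⟩ := r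
  simp only [Rtil, Rc, Matrix.of_apply, Prod.mk.injEq]
  rcases lt_trichotomy i j with h | h | h <;> grind

theorem liftF_Rtil_mul_apply (M : Mat2 N A) (i j : Fin N)
    (r : Fin N × Fin N) :
    (liftF F (Rtil F q N) * M : Mat2 N A) (i, j) r =
      (liftF F (Rc F q N) * M : Mat2 N A) (i, j) r - (q - q⁻¹) • M (j, i) r := by
  simp only [Matrix.mul_apply, liftF, Matrix.map_apply, ← Algebra.smul_def, Rtil_apply,
    sub_smul (Rc F q N _ _), Finset.sum_sub_distrib, ite_smul, zero_smul, Finset.sum_ite_eq',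
    Finset.mem_univ, if_true]

theorem mul_liftF_Rtil_apply (M : Mat2 N A) (a b : Fin N)
    (p : Fin N × Fin N) :
    (M * liftF F (Rtil F q N) : Mat2 N A) p (a, b) =
      (M * liftF F (Rc F q N) : Mat2 N A) p (a, b) - (q - q⁻¹) • M p (b, a) := by
  simp only [Matrix.mul_apply, liftF, Matrix.map_apply, ← Algebra.commutes, ← Algebra.smul_def,
    Rtil_apply, sub_smul (Rc F q N _ _), Finset.sum_sub_distrib, ite_smul, zero_smul]
  congr 1
  rw [Finset.sum_eq_single (b, a)] <;> aesop

/-- The span of the products of two generators whose indices satisfy `C`. -/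
def pairSpan (F : Type) [Field F] {A : Type} [Ring A] [Algebra F A]
    (S : ℕ → Matrix (Fin N) (Fin N) A)
    (C : ℕ × Fin N × Fin N → ℕ × Fin N × Fin N → Prop) : Submodule F A :=
  Submodule.span F {x | ∃ g h, C g h ∧ x = S g.1 g.2.1 g.2.2 * S h.1 h.2.1 h.2.2}

/-- The entries of `R X₁ Rᵗ Y₂ - Y₂ Rᵗ X₁ R`. -/
def reflDefect (q : F) (X Y : Matrix (Fin N) (Fin N) A) (i j a b : Fin N) : A :=
  (if i = j then q else 1) • sandwich q X Y i j a b
    + (if i < j then q - q⁻¹ else 0) • sandwich q X Y j i a b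
    - (if a = b then q else 1) • sandwich q Y X j i b a
    - (if b < a then q - q⁻¹ else 0) • sandwich q Y X j i a b

theorem pairSpan_mono {S : ℕ → Matrix (Fin N) (Fin N) A}
    {C D : ℕ × Fin N × Fin N → ℕ × Fin N × Fin N → Prop} (h : ∀ x y, C x y → D x y) :
    pairSpan F S C ≤ pairSpan F S D :=
  Submodule.span_mono fun _ ⟨g, k, hC, hx⟩ => ⟨g, k, h g k hC, hx⟩

theorem mul_mem_pairSpan {S : ℕ → Matrix (Fin N) (Fin N) A}
    {C : ℕ × Fin N × Fin N → ℕ × Fin N × Fin N → Prop} {r p : ℕ} {i a j b : Fin N}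
    (h : C (r, i, a) (p, j, b)) : S r i a * S p j b ∈ pairSpan F S C :=
  Submodule.subset_span ⟨_, _, h, rfl⟩

/-- The comparison of pairs of degrees: by total degree, then by the first degree. -/
def degLt (m d : ℤ) (x y : ℕ × Fin N × Fin N) : Prop :=
  (x.1 : ℤ) + y.1 < m ∨ ((x.1 : ℤ) + y.1 = m ∧ (x.1 : ℤ) < d)

theorem extZ_mul_extZ_mem {S : ℕ → Matrix (Fin N) (Fin N) A} {m d x y : ℤ}
    (h : x + y < m ∨ (x + y = m ∧ x < d)) (i a j b : Fin N) :
    extZ S x i a * extZ S y j b ∈ pairSpan F S (degLt m d) := by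
  unfold extZ
  split_ifs with hx hy hy
  · refine mul_mem_pairSpan ?_
    simp only [degLt]
    omega
  all_goals simp

theorem sandwich_extZ_mem {S : ℕ → Matrix (Fin N) (Fin N) A} {m d x y : ℤ}
    (h : x + y < m ∨ (x + y = m ∧ x < d)) (i j a b : Fin N) :
    sandwich q (extZ S x) (extZ S y) i j a b ∈ pairSpan F S (degLt m d) :=
  add_mem (Submodule.smul_mem _ _ (extZ_mul_extZ_mem h _ _ _ _))
    (Submodule.smul_mem _ _ (extZ_mul_extZ_mem h _ _ _ _))

theorem liftF_mul_apply_mem {U : Submodule F A} (K : Mat2 N F)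
    {M : Mat2 N A} (h : ∀ p r, M p r ∈ U) (p r) :
    (liftF F K * M : Mat2 N A) p r ∈ U := by
  simp only [Matrix.mul_apply, liftF, Matrix.map_apply, ← Algebra.smul_def]
  exact Submodule.sum_mem _ fun _ _ => Submodule.smul_mem _ _ (h _ _)

theorem mul_liftF_apply_mem {U : Submodule F A} (K : Mat2 N F)
    {M : Mat2 N A} (h : ∀ p r, M p r ∈ U) (p r) :
    (M * liftF F K : Mat2 N A) p r ∈ U := by
  simp only [Matrix.mul_apply, liftF, Matrix.map_apply, ← Algebra.commutes, ← Algebra.smul_def]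
  exact Submodule.sum_mem _ fun _ _ => Submodule.smul_mem _ _ (h _ _)

/-- The affine reflection equation modulo terms of lower total degree. -/
theorem reflDefect_sub_mem {S : ℕ → Matrix (Fin N) (Fin N) A}
    (hS : ∀ a b, affLHS F q S a b = affRHS F q S a b) (d x y : ℤ) (i j a b : Fin N) :
    reflDefect q (extZ S x) (extZ S y) i j a b
      - (reflDefect q (extZ S (x + 1)) (extZ S (y - 1)) i j a b
        - (q - q⁻¹) • (sandwich q (extZ S (x + 1)) (extZ S (y - 1)) j i a b
          - sandwich q (extZ S (y - 1)) (extZ S (x + 1)) j i a b))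
      ∈ pairSpan F S (degLt (x + y) d) := by
  have low12 : ∀ (K : Mat2 N F) (s t : ℤ), s + t < x + y →
      ∀ p r, (amp1 (extZ S s) * liftF F K * amp2 (extZ S t) : Mat2 N A) p r
        ∈ pairSpan F S (degLt (x + y) d) := by
    rintro K s t hst ⟨i, j⟩ ⟨a, b⟩
    rw [amp1_mul_liftF_mul_amp2_apply]
    exact Submodule.sum_mem _ fun _ _ => Submodule.sum_mem _ fun _ _ =>
      Submodule.smul_mem _ _ (extZ_mul_extZ_mem (Or.inl hst) _ _ _ _)
  have low21 : ∀ (K : Mat2 N F) (s t : ℤ), s + t < x + y →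
      ∀ p r, (amp2 (extZ S s) * liftF F K * amp1 (extZ S t) : Mat2 N A) p r
        ∈ pairSpan F S (degLt (x + y) d) := by
    rintro K s t hst ⟨i, j⟩ ⟨a, b⟩
    rw [amp2_mul_liftF_mul_amp1_apply]
    exact Submodule.sum_mem _ fun _ _ => Submodule.sum_mem _ fun _ _ =>
      Submodule.smul_mem _ _ (extZ_mul_extZ_mem (Or.inl hst) _ _ _ _)
  have key := congrFun (congrFun (hS (-x) (2 - y)) (i, j)) (a, b)
  simp only [affLHS, affRHS, z1_eq_amp1, z2_eq_amp2, Matrix.add_apply, Matrix.sub_apply,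
    show - -x = x by ring, show 1 - -x = x + 1 by ring, show 1 - (2 - y) = y - 1 by ring,
    show 2 - (2 - y) = y by ring] at key
  have l1 := liftF_mul_apply_mem (Rtil F q N)
    (low12 (Rtilt F q N) x (-(2 - y)) (by omega)) (i, j) (a, b)
  have l2 := liftF_mul_apply_mem (Rc F q N)
    (low12 (Rtilt F q N) (-1 - -x) (y - 1) (by omega)) (i, j) (a, b)
  have r1 := mul_liftF_apply_mem (Rtil F q N)
    (low21 (Rtilt F q N) (-(2 - y)) x (by omega)) (i, j) (a, b)
  have r2 := mul_liftF_apply_mem (Rc F q N)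
    (low21 (Rtilt F q N) (y - 1) (-1 - -x) (by omega)) (i, j) (a, b)
  simp only [← mul_assoc] at l1 l2
  convert add_mem (sub_mem r1 r2) (sub_mem l2 l1) using 1
  have hx : reflDefect q (extZ S x) (extZ S y) i j a b =
      (liftF F (Rc F q N) * amp1 (extZ S x) * liftF F (Rct F q N) * amp2 (extZ S y) : Mat2 N A) (i, j) (a, b)
      - (amp2 (extZ S y) * liftF F (Rct F q N) * amp1 (extZ S x) * liftF F (Rc F q N) : Mat2 N A)
        (i, j) (a, b) := by
    rw [mul_assoc, mul_assoc, ← mul_assoc (amp1 _), liftF_Rc_mul_apply, mul_liftF_Rc_apply]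
    simp only [amp1_mul_Rct_mul_amp2_apply, amp2_mul_Rct_mul_amp1_apply, reflDefect]
    abel
  have hx' : reflDefect q (extZ S (x + 1)) (extZ S (y - 1)) i j a b
      - (q - q⁻¹) • (sandwich q (extZ S (x + 1)) (extZ S (y - 1)) j i a b
          - sandwich q (extZ S (y - 1)) (extZ S (x + 1)) j i a b) =
      (liftF F (Rtil F q N) * amp1 (extZ S (x + 1)) * liftF F (Rct F q N)
        * amp2 (extZ S (y - 1)) : Mat2 N A) (i, j) (a, b)
      - (amp2 (extZ S (y - 1)) * liftF F (Rct F q N) * amp1 (extZ S (x + 1))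
        * liftF F (Rtil F q N) : Mat2 N A) (i, j) (a, b) := by
    rw [mul_assoc, mul_assoc, ← mul_assoc (amp1 _), liftF_Rtil_mul_apply, mul_liftF_Rtil_apply,
      liftF_Rc_mul_apply, mul_liftF_Rc_apply]
    simp only [amp1_mul_Rct_mul_amp2_apply, amp2_mul_Rct_mul_amp1_apply, reflDefect, smul_sub]
    abel
  rw [hx, hx', ← sub_eq_zero]
  rw [← sub_eq_zero] at key
  rw [← key]
  abel

/-- Products of entries are recovered from the entries of `X₁ Rᵗ Y₂`. -/
theorem mul_mem_of_sandwich_mem {U : Submodule F A} (hq : q ≠ 0)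
    {X Y : Matrix (Fin N) (Fin N) A} {i j : Fin N}
    (h : ∀ j' ≤ j, ∀ a b, sandwich q X Y i j' a b ∈ U) (a b : Fin N) :
    X i a * Y j b ∈ U := by
  have key : ∀ j' ≤ j, ∀ a b, j' ≤ a → X i a * Y j' b ∈ U := by
    intro j' hj' a b hja
    have := h j' hj' a b
    rw [sandwich, if_neg hja.not_gt, zero_smul, add_zero] at this
    refine (Submodule.smul_mem_iff _ ?_).1 this
    split_ifs
    exacts [hq, one_ne_zero]
  rcases le_or_gt j a with hja | haj
  · exact key j le_rfl a b hja
  · have := h j le_rfl a b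
    rw [sandwich, if_neg haj.ne, if_pos haj, one_smul] at this
    exact (Submodule.add_mem_iff_left _ (Submodule.smul_mem _ _ (key a haj.le j b haj.le))).1 this

theorem sandwich_mem_of_reflDefect_mem {U : Submodule F A} (hq : q ≠ 0)
    {X Y : Matrix (Fin N) (Fin N) A} (hE : ∀ i j a b, reflDefect q X Y i j a b ∈ U)
    (hY : ∀ i j a b, sandwich q Y X i j a b ∈ U) (i j a b : Fin N) :
    sandwich q X Y i j a b ∈ U := by
  have h1 : ∀ i j a b, (if i = j then q else 1) • sandwich q X Y i j a b
    + (if i < j then q - q⁻¹ else 0) • sandwich q X Y j i a b ∈ U := by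
    intro i j a b
    have := add_mem (add_mem (hE i j a b)
      (Submodule.smul_mem U (if b < a then q - q⁻¹ else 0) (hY j i a b)))
      (Submodule.smul_mem U (if a = b then q else 1) (hY j i b a))
    simpa [reflDefect] using this
  have h2 : ∀ i j, j ≤ i → sandwich q X Y i j a b ∈ U := by
    intro i j hji
    have := h1 i j a b
    rw [if_neg hji.not_gt, zero_smul, add_zero] at this
    refine (Submodule.smul_mem_iff _ ?_).1 this
    split_ifs
    exacts [hq, one_ne_zero]
  rcases le_or_gt j i with hji | hij
  · exact h2 i j hji
  · have := h1 i j a b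
    rw [if_neg hij.ne, one_smul] at this
    exact (Submodule.add_mem_iff_left _ (Submodule.smul_mem _ _ (h2 j i hij.le))).1 this

theorem reflDefect_extZ_mem {S : ℕ → Matrix (Fin N) (Fin N) A} (hq : q ≠ 0)
    (hS : ∀ a b, affLHS F q S a b = affRHS F q S a b) (m : ℕ) :
    ∀ P : ℕ, 2 * P ≤ m → ∀ i j a b,
      reflDefect q (extZ S (m - P : ℤ)) (extZ S P) i j a b ∈ pairSpan F S (degLt m P) := by
  intro P
  induction P with
  | zero =>
    intro _ i j a b
    simpa [extZ, reflDefect, sandwich] using reflDefect_sub_mem hS 0 m 0 i j a b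
  | succ P ih =>
    intro hP i j a b
    have hmono : pairSpan F S (degLt m P) ≤ pairSpan F S (degLt m (P + 1 : ℕ)) :=
      pairSpan_mono fun _ _ => by
        simp only [degLt]
        omega
    have hY : ∀ i j a b, sandwich q (extZ S P) (extZ S (m - P : ℤ)) i j a b
        ∈ pairSpan F S (degLt m (P + 1 : ℕ)) := fun _ _ _ _ =>
      sandwich_extZ_mem (by omega) _ _ _ _
    have hE : ∀ i j a b, reflDefect q (extZ S (m - P : ℤ)) (extZ S P) i j a b
        ∈ pairSpan F S (degLt m (P + 1 : ℕ)) := fun i j a b => hmono (ih (by omega) i j a b)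
    have hX := sandwich_mem_of_reflDefect_mem hq hE hY
    have := reflDefect_sub_mem hS (P + 1 : ℕ) (m - (P + 1 : ℕ)) (P + 1 : ℕ) i j a b
    rw [show (m - (P + 1 : ℕ) + 1 : ℤ) = m - P by push_cast; ring,
      show ((P + 1 : ℕ) - 1 : ℤ) = P by push_cast; ring, sub_add_cancel] at this
    exact (Submodule.sub_mem_iff_left _ (sub_mem (hE i j a b)
      (Submodule.smul_mem _ _ (sub_mem (hX j i a b) (hY j i a b))))).1 this


theorem mul_mem_of_lower_row {U : Submodule F A} (hq : q ≠ 0) {X : Matrix (Fin N) (Fin N) A}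
    (hE : ∀ i j a b, reflDefect q X X i j a b ∈ U) {i : Fin N}
    (hrow : ∀ k < i, ∀ a l b, X k a * X l b ∈ U) {j : Fin N} (hji : j < i) (a b : Fin N) :
    X i a * X j b ∈ U := by
  have hs : ∀ k < i, ∀ l a b, sandwich q X X k l a b ∈ U := fun k hk l a b =>
    add_mem (Submodule.smul_mem _ _ (hrow k hk _ _ _)) (Submodule.smul_mem _ _ (hrow k hk _ _ _))
  refine mul_mem_of_sandwich_mem hq (fun k hk a b => ?_) a b
  have hki : k < i := hk.trans_lt hji
  have := add_mem (add_mem (hE i k a b)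
    (Submodule.smul_mem U (if b < a then q - q⁻¹ else 0) (hs k hki i a b)))
    (Submodule.smul_mem U (if a = b then q else 1) (hs k hki i b a))
  simpa [reflDefect, hki.ne', hki.not_gt] using this

theorem mul_mem_of_lower_col {U : Submodule F A} (hq : q ≠ 0) {X : Matrix (Fin N) (Fin N) A}
    (hE : ∀ i j a b, reflDefect q X X i j a b ∈ U) {i : Fin N}
    (hrow : ∀ l < i, ∀ a b, X i a * X l b ∈ U) {a b : Fin N} (hba : b < a)
    (hcol : X i b * X i a ∈ U) : X i a * X i b ∈ U := by
  have hsecond : ∀ a b, (if a < i then q - q⁻¹ else 0) • (X i i * X a b) ∈ U := by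
    intro a b
    split_ifs with ha
    · exact Submodule.smul_mem _ _ (hrow a ha i b)
    · simp
  have h1 := hE i i a b
  have h2 : sandwich q X X i i b a ∈ U :=
    add_mem (Submodule.smul_mem _ _ hcol) (hsecond b a)
  have h3 : q⁻¹ • sandwich q X X i i a b ∈ U := by
    convert add_mem h1 h2 using 1
    simp only [reflDefect, hba, hba.ne', if_true, if_false, lt_irrefl, zero_smul, one_smul,
      sub_smul]
    abel
  have h4 := (Submodule.smul_mem_iff _ (inv_ne_zero hq)).1 h3
  have h5 := (Submodule.add_mem_iff_left _ (hsecond a b)).1 h4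
  refine (Submodule.smul_mem_iff _ ?_).1 h5
  split_ifs
  exacts [hq, one_ne_zero]

/-- The comparison of two-letter words `g h` and `x y`: by total degree, then by the degree of the
first letter, the rows of the first and the second letter, and the column of the first letter. -/
def pairLt (x y g h : ℕ × Fin N × Fin N) : Prop :=
  g.1 + h.1 < x.1 + y.1 ∨ (g.1 + h.1 = x.1 + y.1 ∧ (g.1 < x.1 ∨ (g.1 = x.1 ∧
    (g.2.1 < x.2.1 ∨ (g.2.1 = x.2.1 ∧ (h.2.1 < y.2.1 ∨ (h.2.1 = y.2.1 ∧ g.2.2 < x.2.2)))))))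

theorem mul_mem_pairSpan_of_not_tripLe {S : ℕ → Matrix (Fin N) (Fin N) A} (hq : q ≠ 0)
    (hS : ∀ a b, affLHS F q S a b = affRHS F q S a b) {x y : ℕ × Fin N × Fin N}
    (hxy : ¬ tripLe (x.1, x.2.1.val, x.2.2.val) (y.1, y.2.1.val, y.2.2.val)) :
    S x.1 x.2.1 x.2.2 * S y.1 y.2.1 y.2.2 ∈ pairSpan F S (pairLt x y) := by
  obtain ⟨r, i, a⟩ := x
  obtain ⟨p, j, b⟩ := y
  have hext : ∀ r : ℕ, extZ S r = S r := fun r => by simp [extZ]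
  have hcases : p < r ∨ (p = r ∧ (j < i ∨ (j = i ∧ b < a))) := by
    simp only [tripLe] at hxy
    omega
  rcases hcases with hpr | ⟨rfl, hcases⟩
  · have hE : ∀ k l c d, reflDefect q (S r) (S p) k l c d
        ∈ pairSpan F S (pairLt (r, i, a) (p, j, b)) := by
      intro k l c d
      have := reflDefect_extZ_mem hq hS (r + p) p (by omega) k l c d
      rw [show ((r + p : ℕ) - p : ℤ) = r by push_cast; ring, hext, hext] at this
      refine pairSpan_mono (fun g h hgh => ?_) this
      simp only [degLt, pairLt] at hgh ⊢
      omega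
    have hY : ∀ k l c d, sandwich q (S p) (S r) k l c d
        ∈ pairSpan F S (pairLt (r, i, a) (p, j, b)) := by
      have hmul : ∀ k c l d, S p k c * S r l d ∈ pairSpan F S (pairLt (r, i, a) (p, j, b)) :=
        fun k c l d => mul_mem_pairSpan (by simp only [pairLt]; omega)
      exact fun k l c d => add_mem (Submodule.smul_mem _ _ (hmul _ _ _ _))
        (Submodule.smul_mem _ _ (hmul _ _ _ _))
    have hX := sandwich_mem_of_reflDefect_mem hq hE hY
    exact mul_mem_of_sandwich_mem hq (fun k _ => hX i k) a b
  · have hE : ∀ k l c d, reflDefect q (S p) (S p) k l c d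
        ∈ pairSpan F S (pairLt (p, i, a) (p, j, b)) := by
      intro k l c d
      have := reflDefect_extZ_mem hq hS (p + p) p (by omega) k l c d
      rw [show ((p + p : ℕ) - p : ℤ) = p by push_cast; ring, hext] at this
      refine pairSpan_mono (fun g h hgh => ?_) this
      simp only [degLt, pairLt] at hgh ⊢
      omega
    rcases hcases with hji | ⟨rfl, hba⟩
    · refine mul_mem_of_lower_row hq hE (fun k hk c l d => mul_mem_pairSpan ?_) hji a b
      simp [pairLt, hk]
    · refine mul_mem_of_lower_col hq hE (fun l hl c d => mul_mem_pairSpan ?_) hba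
        (mul_mem_pairSpan ?_)
      · simp [pairLt, hl]
      · simp [pairLt, hba]

/-- The well-founded comparison of words refining the total degree. -/
def wordLt : List (ℕ × Fin N × Fin N) → List (ℕ × Fin N × Fin N) → Prop :=
  InvImage (Prod.Lex (· < ·) (Prod.Lex (List.Shortlex (· < ·))
      (Prod.Lex (List.Shortlex (· < ·)) (List.Shortlex (· < ·)))))
    fun l => ((l.map Prod.fst).sum, l.map Prod.fst, l.map fun g => g.2.1, l.map fun g => g.2.2)

theorem wordLt_wf : WellFounded (wordLt (N := N)) :=
  InvImage.wf _ (WellFounded.prod_lex wellFounded_lt (WellFounded.prod_lex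
    (List.Shortlex.wf wellFounded_lt) (WellFounded.prod_lex (List.Shortlex.wf wellFounded_lt)
      (List.Shortlex.wf wellFounded_lt))))

theorem shortlex_append_cons {α : Type} {r : α → α → Prop} (l₁ : List α) {l₂ l₃ : List α}
    (hl : l₂.length = l₃.length) {a b : α} (hab : r a b) :
    List.Shortlex r (l₁ ++ a :: l₂) (l₁ ++ b :: l₃) :=
  (List.Shortlex.of_lex (by simp [hl]) (List.Lex.rel hab)).append_left l₁

theorem wordLt_of_pairLt {x y g h : ℕ × Fin N × Fin N} (hlt : pairLt x y g h)
    (l₁ l₂ : List (ℕ × Fin N × Fin N)) : wordLt (l₁ ++ g :: h :: l₂) (l₁ ++ x :: y :: l₂) := by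
  simp only [wordLt, InvImage, Prod.lex_def, List.map_append, List.map_cons, List.sum_append,
    List.sum_cons]
  rcases hlt with hlt | ⟨htot, hlt⟩
  · left
    omega
  refine Or.inr ⟨by omega, ?_⟩
  rcases hlt with hlt | ⟨hdeg, hlt⟩
  · exact Or.inl (shortlex_append_cons _ (by simp) hlt)
  refine Or.inr ⟨by rw [hdeg, show h.1 = y.1 by omega], ?_⟩
  rcases hlt with hlt | ⟨hrow, hlt⟩
  · exact Or.inl (shortlex_append_cons _ (by simp) hlt)
  rw [hrow]
  rcases hlt with hlt | ⟨hrow', hlt⟩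
  · left
    simpa using shortlex_append_cons (l₁.map (fun g => g.2.1) ++ [x.2.1]) (l₂ := l₂.map _) rfl hlt
  · exact Or.inr ⟨by rw [hrow'], shortlex_append_cons _ (by simp) hlt⟩

/-- The monomial attached to a word in the generators. -/
def wordProd (S : ℕ → Matrix (Fin N) (Fin N) A) (l : List (ℕ × Fin N × Fin N)) : A :=
  (l.map fun p => S p.1 p.2.1 p.2.2).prod

theorem wordProd_mem_span_sorted {S : ℕ → Matrix (Fin N) (Fin N) A} (hq : q ≠ 0)
    (hS : ∀ a b, affLHS F q S a b = affRHS F q S a b) (l : List (ℕ × Fin N × Fin N)) :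
    wordProd S l ∈ Submodule.span F {x | ∃ l, sortedGens l ∧ x = wordProd S l} := by
  induction l using wordLt_wf.induction with
  | _ l ih =>
    by_cases hl : sortedGens l
    · exact Submodule.subset_span ⟨l, hl, rfl⟩
    · change ¬ List.IsChain _ _ at hl
      rw [List.isChain_iff_forall_rel_of_append_cons_cons] at hl
      push Not at hl
      obtain ⟨x, y, l₁, l₂, rfl, hxy⟩ := hl
      have hmap : ∀ g h, wordProd S (l₁ ++ g :: h :: l₂) =
          (LinearMap.mulLeft F (wordProd S l₁) ∘ₗ LinearMap.mulRight F (wordProd S l₂))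
            (S g.1 g.2.1 g.2.2 * S h.1 h.2.1 h.2.2) := by
        simp [wordProd, mul_assoc]
      rw [hmap, ← Submodule.mem_comap]
      refine Submodule.span_le.2 ?_ (mul_mem_pairSpan_of_not_tripLe hq hS hxy)
      rintro _ ⟨g, h, hgh, rfl⟩
      rw [SetLike.mem_coe, Submodule.mem_comap, ← hmap]
      exact ih _ (wordLt_of_pairLt hgh l₁ l₂)

theorem span_sorted_wordProd_eq_top {S : ℕ → Matrix (Fin N) (Fin N) A} (hq : q ≠ 0)
    (hS : ∀ a b, affLHS F q S a b = affRHS F q S a b)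
    (hgen : Algebra.adjoin F
      (Set.range fun p : ℕ × Fin N × Fin N => S p.1 p.2.1 p.2.2) = ⊤) :
    Submodule.span F {x | ∃ l, sortedGens l ∧ x = wordProd S l} = ⊤ := by
  rw [eq_top_iff, ← Algebra.top_toSubmodule, ← hgen, Algebra.adjoin_eq_span, Submodule.span_le]
  intro x hx
  obtain ⟨l, hl, rfl⟩ := Submonoid.exists_list_of_mem_closure hx
  obtain ⟨w, rfl⟩ : l ∈ Set.range (List.map fun p : ℕ × Fin N × Fin N => S p.1 p.2.1 p.2.2) := by
    rwa [Set.range_list_map]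
  exact wordProd_mem_span_sorted hq hS w

theorem z1_map {B : Type} [Ring B] (f : A →+* B) (S : ℕ → Matrix (Fin N) (Fin N) A) (r : ℤ) :
    (z1 S r).map f = z1 (fun n => (S n).map f) r := by
  ext p s
  by_cases hr : 0 ≤ r <;> simp [z1, hr, amp1, apply_ite f]

theorem z2_map {B : Type} [Ring B] (f : A →+* B) (S : ℕ → Matrix (Fin N) (Fin N) A) (r : ℤ) :
    (z2 S r).map f = z2 (fun n => (S n).map f) r := by
  ext p s
  by_cases hr : 0 ≤ r <;> simp [z2, hr, amp2, apply_ite f]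

theorem liftF_map {B : Type} [Ring B] [Algebra F B] (f : A →ₐ[F] B) (M : Mat2 N F) :
    (liftF F M : Mat2 N A).map (f : A →+* B) = liftF F M := by
  ext p s
  simp [liftF]

theorem affLHS_map {B : Type} [Ring B] [Algebra F B] (f : A →ₐ[F] B)
    (S : ℕ → Matrix (Fin N) (Fin N) A) (a b : ℤ) :
    (affLHS F q S a b).map (f : A →+* B) =
      affLHS F q (fun n => (S n).map (f : A →+* B)) a b := by
  simp only [affLHS, Matrix.map_add _ (map_add (f : A →+* B)),
    Matrix.map_sub _ (map_sub (f : A →+* B)), Matrix.map_mul, z1_map, z2_map, liftF_map]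

theorem affRHS_map {B : Type} [Ring B] [Algebra F B] (f : A →ₐ[F] B)
    (S : ℕ → Matrix (Fin N) (Fin N) A) (a b : ℤ) :
    (affRHS F q S a b).map (f : A →+* B) =
      affRHS F q (fun n => (S n).map (f : A →+* B)) a b := by
  simp only [affRHS, Matrix.map_add _ (map_add (f : A →+* B)),
    Matrix.map_sub _ (map_sub (f : A →+* B)), Matrix.map_mul, z1_map, z2_map, liftF_map]

theorem s9_affLHS_eq_affRHS (q : F) (N : ℕ) (a b : ℤ) :
    affLHS F q (fun r => Matrix.of (s9 F q N r)) a b =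
      affRHS F q (fun r => Matrix.of (s9 F q N r)) a b := by
  have hmap : (fun r => Matrix.of (s9 F q N r)) = fun r => (SfreeA F N r).map
      (RingQuot.mkAlgHom F (Rel9 F q N) : FreeAlgebra F (ℕ × Fin N × Fin N) →+* Alg9 F q N) :=
    rfl
  rw [hmap, ← affLHS_map, ← affRHS_map]
  ext p r
  exact RingQuot.mkAlgHom_rel F (Rel9.refl a b p r)

theorem adjoin_range_s9 (q : F) (N : ℕ) :
    Algebra.adjoin F (Set.range fun p : ℕ × Fin N × Fin N => s9 F q N p.1 p.2.1 p.2.2) = ⊤ := by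
  have h := congrArg (Subalgebra.map (RingQuot.mkAlgHom F (Rel9 F q N)))
    (FreeAlgebra.adjoin_range_ι F (ℕ × Fin N × Fin N))
  rw [AlgHom.map_adjoin, ← Set.range_comp, Algebra.map_top,
    (AlgHom.range_eq_top _).2 (RingQuot.mkAlgHom_surjective F (Rel9 F q N))] at h
  exact h

end ReflectionAlgebra

/-- In the algebra with generators `s_ij^{(r)}` and the coefficientwise
affine reflection equation as defining relations, the ordered monomials in the
generators (ordered lexicographically by `(r,i,j)`) span the algebra. -/
theorem stmt9 (N : ℕ) :
    Submodule.span FF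
        {x : Alg9 FF qq N | ∃ l : List (ℕ × Fin N × Fin N), sortedGens l ∧
          x = (l.map fun p => s9 FF qq N p.1 p.2.1 p.2.2).prod} = ⊤ :=
  span_sorted_wordProd_eq_top RatFunc.X_ne_zero (s9_affLHS_eq_affRHS qq N) (adjoin_range_s9 qq N)
end
end
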